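/- For the hard label-shift family, with V drawn uniformly from {−1,0,1}^K × {−1,0,1}^K and P_{V,test}(x,y) = (1/2)(P_{V,1}(x)·1{y=1} + P_{V,−1}(x)·1{y=−1}), the expected Bayes risk satisfies E_V[ R(f*(P_{V,test}); P_{V,test}) ] = (1/2)·(1 − 1/(18K)). -/

import Mathlib

open MeasureTheory Set
open scoped ENNReal Classical

noncomputable section

/-! ## Basic setup: distributions on `ℝ × Bool`, risk, excess risk.

A labelled example is a pair `(x, y) : ℝ × Bool`, where the label `true` codes `+1`
and `false` codes `-1`; features are supported on `[0,1]`. -/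

/-- The risk (probability of misclassification) of a classifier `f : ℝ → Bool`
under a distribution `P` on `ℝ × Bool`. -/
def risk (f : ℝ → Bool) (P : Measure (ℝ × Bool)) : ℝ :=
  (P {p : ℝ × Bool | f p.1 ≠ p.2}).toReal

/-- The Bayes risk of a distribution: the infimum of the risk over all classifiers. -/
def bayesRisk (P : Measure (ℝ × Bool)) : ℝ :=
  ⨅ f : ℝ → Bool, risk f P

/-- The balanced test distribution `P_test = (1/2) P_maj + (1/2) P_min`. -/
def testMeasure (Pmaj Pmin : Measure (ℝ × Bool)) : Measure (ℝ × Bool) :=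
  (2 : ℝ≥0∞)⁻¹ • Pmaj + (2 : ℝ≥0∞)⁻¹ • Pmin

/-- A training sample: `nmaj` labelled points from the majority distribution and
`nmin` labelled points from the minority distribution. -/
abbrev Sample (nmaj nmin : ℕ) : Type :=
  (Fin nmaj → ℝ × Bool) × (Fin nmin → ℝ × Bool)

/-- The law `P_maj^{n_maj} × P_min^{n_min}` of the training sample. -/
def sampleMeasure (nmaj nmin : ℕ) (Pmaj Pmin : Measure (ℝ × Bool)) :
    Measure (Sample nmaj nmin) :=
  (Measure.pi fun _ : Fin nmaj => Pmaj).prod (Measure.pi fun _ : Fin nmin => Pmin)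

/-- An algorithm (a map from samples to classifiers) is measurable if the joint map
`(S, x) ↦ A S x` is measurable. -/
def MeasurableAlg (nmaj nmin : ℕ) (A : Sample nmaj nmin → ℝ → Bool) : Prop :=
  Measurable fun p : Sample nmaj nmin × ℝ => A p.1 p.2

/-- The expected excess risk of the algorithm `A` on the pair `(P_maj, P_min)`:
`E_{S ~ P_maj^{n_maj} × P_min^{n_min}}[R(A^S; P_test)] - R(f^*; P_test)`. -/
def excessRisk (nmaj nmin : ℕ) (A : Sample nmaj nmin → ℝ → Bool)
    (Pmaj Pmin : Measure (ℝ × Bool)) : ℝ :=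
  (∫ S, risk (A S) (testMeasure Pmaj Pmin) ∂sampleMeasure nmaj nmin Pmaj Pmin)
    - bayesRisk (testMeasure Pmaj Pmin)

/-- The distribution on `ℝ × Bool` supported on label `y` whose feature has density `p`
(w.r.t. Lebesgue measure) on `[0,1]`. -/
def labelMeasure (p : ℝ → ℝ) (y : Bool) : Measure (ℝ × Bool) :=
  Measure.map (fun x => (x, y))
    ((volume.restrict (Icc (0:ℝ) 1)).withDensity fun x => ENNReal.ofReal (p x))

/-- The label-shift class `𝒫_LS`: `P_maj(x,y) = P₁(x)·1{y = 1}`,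
`P_min(x,y) = P₋₁(x)·1{y = -1}` with `P₁, P₋₁` 1-Lipschitz densities on `[0,1]`. -/
def memLS (Pmaj Pmin : Measure (ℝ × Bool)) : Prop :=
  ∃ p1 pm1 : ℝ → ℝ,
    (∀ x, 0 ≤ p1 x) ∧ (∀ x, 0 ≤ pm1 x) ∧
    LipschitzOnWith 1 p1 (Icc 0 1) ∧ LipschitzOnWith 1 pm1 (Icc 0 1) ∧
    (∫ x in Icc (0:ℝ) 1, p1 x) = 1 ∧ (∫ x in Icc (0:ℝ) 1, pm1 x) = 1 ∧
    Pmaj = labelMeasure p1 true ∧ Pmin = labelMeasure pm1 false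

/-- Total variation distance between two densities on `[0,1]`:
`TV(p, q) = (1/2)∫₀¹ |p - q|`. -/
def tvDist (p q : ℝ → ℝ) : ℝ :=
  (1/2) * ∫ x in Icc (0:ℝ) 1, |p x - q x|

/-- The distribution on `ℝ × Bool` whose feature has density `p` on `[0,1]` and whose
label is `true` with probability `η x` conditionally on the feature `x`. -/
def covMeasure (p η : ℝ → ℝ) : Measure (ℝ × Bool) :=
  labelMeasure (fun x => p x * η x) true + labelMeasure (fun x => p x * (1 - η x)) false

/-- The group-covariate shift class `𝒫_GS(τ)`: `P_maj(x,y) = P_a(x)·P(y|x)`,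
`P_min(x,y) = P_b(x)·P(y|x)` with group densities `P_a, P_b` on `[0,1]`,
a shared 1-Lipschitz conditional label distribution, and overlap
`1 - TV(P_a, P_b) ≥ τ`. -/
def memGS (τ : ℝ) (Pmaj Pmin : Measure (ℝ × Bool)) : Prop :=
  ∃ pa pb η : ℝ → ℝ,
    (∀ x, 0 ≤ pa x) ∧ (∀ x, 0 ≤ pb x) ∧
    (∫ x in Icc (0:ℝ) 1, pa x) = 1 ∧ (∫ x in Icc (0:ℝ) 1, pb x) = 1 ∧
    (∀ x, 0 ≤ η x ∧ η x ≤ 1) ∧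
    LipschitzOnWith 1 η (Icc 0 1) ∧ LipschitzOnWith 1 (fun x => 1 - η x) (Icc 0 1) ∧
    τ ≤ 1 - tvDist pa pb ∧
    Pmaj = covMeasure pa η ∧ Pmin = covMeasure pb η

/-! ## The hat function -/

/-- The hat function `φ_K`. -/
def hatFun (K : ℕ) (x : ℝ) : ℝ :=
  if x ∈ Icc (-(1/(2*(K:ℝ)))) 0 then |x + 1/(4*(K:ℝ))| - 1/(4*(K:ℝ))
  else if x ∈ Icc (0:ℝ) (1/(2*(K:ℝ))) then 1/(4*(K:ℝ)) - |x - 1/(4*(K:ℝ))|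
  else 0

/-! ## The hard family for the label-shift lower bound.

Bins are 0-indexed: `I_j = [j/K, (j+1)/K)` for `j = 0, …, K-1`, corresponding to the
paper's `I_{j+1} = [((j+1)-1)/K, (j+1)/K]`; the bin center is `(j + 1/2)/K`. -/

/-- The value in `{-1, 0, 1}` coded by an element of `Fin 3`. -/
def trit (i : Fin 3) : ℝ := (i : ℝ) - 1

/-- The perturbed density of the hard label-shift family: on the bin
`I_j = [j/K, (j+1)/K)` it equals `1 + v_j · φ_K(x - (j + 1/2)/K)`. -/
def hardDensityLS (K : ℕ) (v : Fin K → Fin 3) (x : ℝ) : ℝ :=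
  1 + ∑ j : Fin K,
    (if x ∈ Ico ((j:ℝ)/(K:ℝ)) (((j:ℝ)+1)/(K:ℝ))
      then trit (v j) * hatFun K (x - ((j:ℝ) + 1/2)/(K:ℝ)) else 0)

/-- The index set `𝒱 = {-1,0,1}^K × {-1,0,1}^K` of the hard label-shift family. -/
abbrev TritPair (K : ℕ) : Type := (Fin K → Fin 3) × (Fin K → Fin 3)

/-- The law `Q(S | v) = P_{v,maj}^{n_maj} × P_{v,min}^{n_min}` of the sample for the hard
label-shift instance indexed by `v`. -/
def hardLSMeasure (K nmaj nmin : ℕ) (v : TritPair K) : Measure (Sample nmaj nmin) :=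
  sampleMeasure nmaj nmin (labelMeasure (hardDensityLS K v.1) true)
    (labelMeasure (hardDensityLS K v.2) false)

/-- The marginal law `Q_S` of the sample when the index `V` is uniform on `𝒱`. -/
def hardLSMarginal (K nmaj nmin : ℕ) : Measure (Sample nmaj nmin) :=
  ∑ v : TritPair K, (Fintype.card (TritPair K) : ℝ≥0∞)⁻¹ • hardLSMeasure K nmaj nmin v

/-- The posterior weight `Q(v | S)`: the Radon–Nikodym derivative of
`(1/|𝒱|) · Q(S | v)` with respect to `Q_S`, evaluated at `S`. -/
def postLS (K nmaj nmin : ℕ) (v : TritPair K) (S : Sample nmaj nmin) : ℝ :=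
  (((Fintype.card (TritPair K) : ℝ≥0∞)⁻¹ • hardLSMeasure K nmaj nmin v).rnDeriv
      (hardLSMarginal K nmaj nmin) S).toReal

/-- The posterior mixture density `Σ_{v ∈ 𝒱} Q(v | S) · P_{v, ±1}`;
`cls = true` selects the class `+1` densities `P_{v,1}`. -/
def postMixLS (K nmaj nmin : ℕ) (S : Sample nmaj nmin) (cls : Bool) (x : ℝ) : ℝ :=
  ∑ v : TritPair K,
    postLS K nmaj nmin v S * hardDensityLS K (if cls then v.1 else v.2) x

/-! ## The hard family for the group-covariate shift lower bound -/

/-- The sign `+1` / `-1` coded by a Bool. -/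
def sgnB (b : Bool) : ℝ := if b then 1 else -1

/-- `P_v(y = 1 | x)` for the hard group-shift family: on the bin `I_j = [j/K, (j+1)/K)` it
equals `(1/2)(1 + v_j · φ_K(x - (j+1/2)/K))`. -/
def hardEta (K : ℕ) (v : Fin K → Bool) (x : ℝ) : ℝ :=
  (1/2) * (1 + ∑ j : Fin K,
    (if x ∈ Ico ((j:ℝ)/(K:ℝ)) (((j:ℝ)+1)/(K:ℝ))
      then sgnB (v j) * hatFun K (x - ((j:ℝ) + 1/2)/(K:ℝ)) else 0))

/-- The majority-group feature density: `2 - τ` on `[0, 1/2)` and `τ` on `[1/2, 1]`. -/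
def hardPa (τ : ℝ) (x : ℝ) : ℝ := if x < 1/2 then 2 - τ else τ

/-- The minority-group feature density `P_b = 2 - P_a`. -/
def hardPb (τ : ℝ) (x : ℝ) : ℝ := 2 - hardPa τ x

/-- The law `Q(S | v)` of the sample for the hard group-shift instance indexed by `v`. -/
def hardGSMeasure (K nmaj nmin : ℕ) (τ : ℝ) (v : Fin K → Bool) :
    Measure (Sample nmaj nmin) :=
  sampleMeasure nmaj nmin (covMeasure (hardPa τ) (hardEta K v))
    (covMeasure (hardPb τ) (hardEta K v))

/-- The conditional law `Q(S | v_j = b)` of the sample given the `j`-th coordinate of the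
uniformly random index: the uniform mixture over all `v` with `v_j = b`. -/
def condGS (K nmaj nmin : ℕ) (τ : ℝ) (j : Fin K) (b : Bool) :
    Measure (Sample nmaj nmin) :=
  ((Finset.univ.filter fun v : Fin K → Bool => v j = b).card : ℝ≥0∞)⁻¹ •
    ∑ v ∈ Finset.univ.filter (fun v : Fin K → Bool => v j = b),
      hardGSMeasure K nmaj nmin τ v

/-- The Kullback–Leibler divergence `KL(μ ‖ ν) = ∫ log (dμ/dν) dμ`. -/
def klDiv' {α : Type*} [MeasurableSpace α] (μ ν : Measure α) : ℝ :=
  ∫ x, Real.log ((μ.rnDeriv ν x).toReal) ∂μ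

/-! ## The undersampled binning estimator -/

/-- The prediction of the undersampled binning estimator on the bin `I_j = [j/K, (j+1)/K)`
(0-indexed), where `s ⊆ Fin nmaj` is the set of retained majority samples: predict `+1`
iff the samples of the undersampled dataset in the bin with label `+1` strictly
outnumber those with label `-1`. -/
def usbBinPred (nmaj nmin K : ℕ) (s : Finset (Fin nmaj)) (S : Sample nmaj nmin)
    (j : ℕ) : Bool :=
  decide
    ((s.filter fun i => (S.1 i).2 = false ∧
        (S.1 i).1 ∈ Ico ((j:ℝ)/(K:ℝ)) (((j:ℝ)+1)/(K:ℝ))).card +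
      (Finset.univ.filter fun i : Fin nmin => (S.2 i).2 = false ∧
        (S.2 i).1 ∈ Ico ((j:ℝ)/(K:ℝ)) (((j:ℝ)+1)/(K:ℝ))).card
      <
      (s.filter fun i => (S.1 i).2 = true ∧
        (S.1 i).1 ∈ Ico ((j:ℝ)/(K:ℝ)) (((j:ℝ)+1)/(K:ℝ))).card +
      (Finset.univ.filter fun i : Fin nmin => (S.2 i).2 = true ∧
        (S.2 i).1 ∈ Ico ((j:ℝ)/(K:ℝ)) (((j:ℝ)+1)/(K:ℝ))).card)

/-- The undersampled binning classifier `A_USB^{S,K}` with `K` bins, given the retained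
majority samples `s`: on each bin it predicts the majority label among the undersampled
data in that bin. -/
def usbClassifier (nmaj nmin K : ℕ) (s : Finset (Fin nmaj)) (S : Sample nmaj nmin) :
    ℝ → Bool :=
  fun x => usbBinPred nmaj nmin K s S (min ⌊x * (K:ℝ)⌋₊ (K - 1))

/-- The expected excess risk of the undersampled binning estimator with `K` bins, where the
`nmin` retained majority samples are drawn uniformly at random without replacement
(uniformly among all subsets of size `nmin`). -/
def usbExcessRisk (nmaj nmin K : ℕ) (Pmaj Pmin : Measure (ℝ × Bool)) : ℝ :=
  (∑ s ∈ Finset.powersetCard nmin (Finset.univ : Finset (Fin nmaj)),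
      ∫ S, risk (usbClassifier nmaj nmin K s S) (testMeasure Pmaj Pmin)
        ∂sampleMeasure nmaj nmin Pmaj Pmin)
    / ((Finset.powersetCard nmin (Finset.univ : Finset (Fin nmaj))).card : ℝ)
  - bayesRisk (testMeasure Pmaj Pmin)

/-- `q_{j,y} = P(y | x ∈ I_j)` for the 0-indexed bin `I_j = [j/K, (j+1)/K)`. -/
def qBin (P : Measure (ℝ × Bool)) (K j : ℕ) (y : Bool) : ℝ :=
  (P ((Ico ((j:ℝ)/(K:ℝ)) (((j:ℝ)+1)/(K:ℝ))) ×ˢ ({y} : Set Bool))).toReal /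
    (P ((Ico ((j:ℝ)/(K:ℝ)) (((j:ℝ)+1)/(K:ℝ))) ×ˢ (univ : Set Bool))).toReal

/-- The excess risk of the binning estimator in the bin `I_j`:
`R_j(A_USB^S) = q_{j, -A_j^S} - min{q_{j,1}, q_{j,-1}}`. -/
def binExcess (nmaj nmin K : ℕ) (s : Finset (Fin nmaj)) (S : Sample nmaj nmin)
    (P : Measure (ℝ × Bool)) (j : ℕ) : ℝ :=
  qBin P K j (!(usbBinPred nmaj nmin K s S j)) - min (qBin P K j true) (qBin P K j false)

/-- The binomial probability mass function `P[Bin(m, p) = k]`. -/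
def binomPMF (m : ℕ) (p : ℝ) (k : ℕ) : ℝ :=
  (m.choose k : ℝ) * p ^ k * (1 - p) ^ (m - k)
lemma measurable_hatFun (K : ℕ) : Measurable (hatFun K) := by
  unfold hatFun
  refine Measurable.ite measurableSet_Icc (by fun_prop) (Measurable.ite measurableSet_Icc ?_ ?_)
  · fun_prop
  · fun_prop

lemma abs_hatFun_le (K : ℕ) (hK : 0 < K) (x : ℝ) : |hatFun K x| ≤ 1 / (4 * (K : ℝ)) := by
  have hK' : (0 : ℝ) < K := by exact_mod_cast hK
  have ha : 0 < 1 / (4 * (K : ℝ)) := by positivity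
  have h2 : 1 / (2 * (K : ℝ)) = 2 * (1 / (4 * (K : ℝ))) := by field_simp; norm_num
  unfold hatFun
  rw [h2]
  generalize 1 / (4 * (K : ℝ)) = a at *
  split_ifs with h h'
  · rw [mem_Icc] at h
    cases abs_cases (x + a) <;> rw [abs_le] <;> constructor <;> linarith
  · rw [mem_Icc] at h'
    cases abs_cases (x - a) <;> rw [abs_le] <;> constructor <;> linarith
  · simpa using ha.le

lemma abs_trit_le (i : Fin 3) : |trit i| ≤ 1 := by
  fin_cases i <;> (simp [trit]; try norm_num)

lemma abs_trit_mul_hatFun_le (K : ℕ) (hK : 0 < K) (i : Fin 3) (x : ℝ) :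
    |trit i * hatFun K x| ≤ 1 := by
  have h1 := abs_hatFun_le K hK x
  have h2 := abs_trit_le i
  have hK' : (1 : ℝ) ≤ K := by exact_mod_cast hK
  have h3 : 1 / (4 * (K : ℝ)) ≤ 1 := by
    rw [div_le_one (by positivity)]; linarith
  rw [abs_mul]
  exact mul_le_one₀ h2 (abs_nonneg _) (h1.trans h3)

lemma mem_bin_iff (K : ℕ) (hK : 0 < K) (j : Fin K) (x : ℝ) :
    x ∈ Ico ((j : ℝ) / (K : ℝ)) (((j : ℝ) + 1) / (K : ℝ)) ↔ ⌊x * K⌋ = (j : ℤ) := by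
  have hK' : (0 : ℝ) < K := by exact_mod_cast hK
  rw [mem_Ico, Int.floor_eq_iff, div_le_iff₀ hK', lt_div_iff₀ hK']
  simp

/-- Among sums of functions supported on the bins, at most one summand is nonzero. -/
lemma exists_sum_bin_eq (K : ℕ) (hK : 0 < K) (x : ℝ) :
    (∀ g : Fin K → ℝ, (∑ j : Fin K,
      if x ∈ Ico ((j : ℝ) / (K : ℝ)) (((j : ℝ) + 1) / (K : ℝ)) then g j else 0) = 0) ∨
    ∃ i : Fin K, ∀ g : Fin K → ℝ, (∑ j : Fin K,
      if x ∈ Ico ((j : ℝ) / (K : ℝ)) (((j : ℝ) + 1) / (K : ℝ)) then g j else 0) = g i := by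
  simp only [mem_bin_iff K hK]
  by_cases h : ∃ i : Fin K, ⌊x * K⌋ = (i : ℤ)
  · obtain ⟨i, hi⟩ := h
    refine Or.inr ⟨i, fun g => ?_⟩
    rw [Finset.sum_eq_single i]
    · simp [hi]
    · intro j _ hj
      rw [if_neg]
      rw [hi]
      intro h
      exact hj (Fin.ext (by exact_mod_cast h.symm))
    · simp
  · push Not at h
    refine Or.inl fun g => Finset.sum_eq_zero fun j _ => if_neg (h j)

lemma hardDensityLS_nonneg (K : ℕ) (hK : 0 < K) (v : Fin K → Fin 3) (x : ℝ) :
    0 ≤ hardDensityLS K v x := by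
  unfold hardDensityLS
  rcases exists_sum_bin_eq K hK x with h | ⟨i, h⟩
  · rw [h]; norm_num
  · rw [h fun j => trit (v j) * hatFun K (x - ((j : ℝ) + 1 / 2) / K)]
    have := (abs_le.1 (abs_trit_mul_hatFun_le K hK (v i) (x - ((i : ℝ) + 1 / 2) / K))).1
    linarith

lemma measurable_hardDensityLS (K : ℕ) (v : Fin K → Fin 3) : Measurable (hardDensityLS K v) := by
  unfold hardDensityLS
  refine measurable_const.add (Finset.measurable_sum _ fun j _ => ?_)
  refine Measurable.ite measurableSet_Ico ?_ measurable_const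
  exact ((measurable_hatFun K).comp (measurable_id.sub_const _)).const_mul _

lemma min_hardDensityLS (K : ℕ) (hK : 0 < K) (u v : Fin K → Fin 3) (x : ℝ) :
    min (hardDensityLS K u x) (hardDensityLS K v x) = 1 + ∑ j : Fin K,
      (Ico ((j : ℝ) / (K : ℝ)) (((j : ℝ) + 1) / (K : ℝ))).indicator (fun x =>
        min (trit (u j) * hatFun K (x - ((j : ℝ) + 1 / 2) / K))
          (trit (v j) * hatFun K (x - ((j : ℝ) + 1 / 2) / K))) x := by
  unfold hardDensityLS
  simp only [indicator_apply]
  rcases exists_sum_bin_eq K hK x with h | ⟨i, h⟩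
  · simp only [h, min_self]
  · rw [h fun j => trit (u j) * hatFun K (x - ((j : ℝ) + 1 / 2) / K),
      h fun j => trit (v j) * hatFun K (x - ((j : ℝ) + 1 / 2) / K),
      h fun j => min (trit (u j) * hatFun K (x - ((j : ℝ) + 1 / 2) / K))
          (trit (v j) * hatFun K (x - ((j : ℝ) + 1 / 2) / K)), min_add_add_left]

lemma integral_sub_abs (a : ℝ) (ha : 0 ≤ a) : ∫ u in (-a)..a, (a - |u|) = a ^ 2 := by
  have hi : ∀ b c : ℝ, IntervalIntegrable (fun u : ℝ => a - |u|) volume b c := fun b c =>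
    Continuous.intervalIntegrable (by fun_prop) b c
  rw [← intervalIntegral.integral_add_adjacent_intervals (hi (-a) 0) (hi 0 a)]
  have h1 : ∫ u in (-a)..0, (a - |u|) = ∫ u in (-a)..0, (a + u) :=
    intervalIntegral.integral_congr fun u hu => by
      rw [uIcc_of_le (by linarith), mem_Icc] at hu
      simp only [abs_of_nonpos hu.2, sub_neg_eq_add]
  have h2 : ∫ u in (0 : ℝ)..a, (a - |u|) = ∫ u in (0 : ℝ)..a, (a - u) :=
    intervalIntegral.integral_congr fun u hu => by
      rw [uIcc_of_le ha, mem_Icc] at hu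
      simp only [abs_of_nonneg hu.1]
  rw [h1, h2, intervalIntegral.integral_add (by simp) (by simp),
    intervalIntegral.integral_sub (by simp) (by simp)]
  simp only [intervalIntegral.integral_const, integral_id, smul_eq_mul]
  ring

lemma integral_min_mul_hatFun (K : ℕ) (hK : 0 < K) (s t : ℝ) :
    ∫ x in (-(1 / (2 * (K : ℝ))))..(1 / (2 * (K : ℝ))),
      min (s * hatFun K x) (t * hatFun K x) = -|s - t| / (16 * (K : ℝ) ^ 2) := by
  have hK' : (0 : ℝ) < K := by exact_mod_cast hK
  have ha : 0 < 1 / (4 * (K : ℝ)) := by positivity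
  have h2 : 1 / (2 * (K : ℝ)) = 2 * (1 / (4 * (K : ℝ))) := by field_simp; norm_num
  have h3 : -|s - t| / (16 * (K : ℝ) ^ 2) = -|s - t| * (1 / (4 * (K : ℝ))) ^ 2 := by
    field_simp; norm_num
  rw [h3, h2]
  unfold hatFun
  rw [h2]
  generalize 1 / (4 * (K : ℝ)) = a at *
  set f : ℝ → ℝ := fun x => if x ∈ Icc (-(2 * a)) 0 then |x + a| - a
    else if x ∈ Icc (0 : ℝ) (2 * a) then a - |x - a| else 0 with hf
  have e1 : EqOn (fun x => min (s * f x) (t * f x)) (fun x => -max s t * (a - |x + a|))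
      (uIcc (-(2 * a)) 0) := fun x hx => by
    rw [uIcc_of_le (by linarith)] at hx
    have : f x = -(a - |x + a|) := by simp only [hf]; rw [if_pos hx]; ring
    have hw : 0 ≤ a - |x + a| := by
      rw [mem_Icc] at hx
      cases abs_cases (x + a) <;> linarith
    simp only [this]
    rw [mul_neg, mul_neg, min_neg_neg, ← max_mul_of_nonneg _ _ hw, neg_mul]
  have e2 : EqOn (fun x => min (s * f x) (t * f x)) (fun x => min s t * (a - |x - a|))
      (uIcc 0 (2 * a)) := fun x hx => by
    rw [uIcc_of_le (by linarith)] at hx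
    have : f x = a - |x - a| := by
      simp only [hf]
      split_ifs with h
      · have : x = 0 := le_antisymm h.2 hx.1
        simp [this, abs_of_pos ha]
      · rfl
    have hw : 0 ≤ a - |x - a| := by
      rw [mem_Icc] at hx
      cases abs_cases (x - a) <;> linarith
    simp only [this]
    rw [← min_mul_of_nonneg _ _ hw]
  have i1 : IntervalIntegrable (fun x => min (s * f x) (t * f x)) volume (-(2 * a)) 0 :=
    (Continuous.intervalIntegrable (u := fun x => -max s t * (a - |x + a|))
      (by fun_prop) _ _).congr (e1.symm.mono uIoc_subset_uIcc)
  have i2 : IntervalIntegrable (fun x => min (s * f x) (t * f x)) volume 0 (2 * a) :=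
    (Continuous.intervalIntegrable (u := fun x => min s t * (a - |x - a|))
      (by fun_prop) _ _).congr (e2.symm.mono uIoc_subset_uIcc)
  change ∫ x in (-(2 * a))..(2 * a), min (s * f x) (t * f x) = _
  rw [← intervalIntegral.integral_add_adjacent_intervals i1 i2,
    intervalIntegral.integral_congr e1, intervalIntegral.integral_congr e2,
    intervalIntegral.integral_const_mul, intervalIntegral.integral_const_mul,
    intervalIntegral.integral_comp_add_right (fun u => a - |u|),
    intervalIntegral.integral_comp_sub_right (fun u => a - |u|)]
  have r1 : -(2 * a) + a = -a := by ring
  have r2 : 2 * a - a = a := by ring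
  rw [r1, r2, zero_add, zero_sub, integral_sub_abs a ha.le]
  rw [abs_sub_comm, ← max_sub_min_eq_abs s t]
  ring

lemma integrable_min_hatFun (K : ℕ) (hK : 0 < K) (i k : Fin 3) (c : ℝ) :
    IntegrableOn (fun x => min (trit i * hatFun K (x - c)) (trit k * hatFun K (x - c)))
      (Icc (0 : ℝ) 1) := by
  have hm : Measurable fun x => hatFun K (x - c) :=
    (measurable_hatFun K).comp (measurable_id.sub_const _)
  refine Measure.integrableOn_of_bounded (M := 1) (by simp)
    ((hm.const_mul _).min (hm.const_mul _)).aestronglyMeasurable (.of_forall fun x => ?_)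
  rw [Real.norm_eq_abs]
  rcases min_choice (trit i * hatFun K (x - c)) (trit k * hatFun K (x - c)) with h | h <;> rw [h] <;>
    exact abs_trit_mul_hatFun_le K hK _ _

lemma integrableOn_min_hardDensityLS (K : ℕ) (hK : 0 < K) (u v : Fin K → Fin 3) :
    IntegrableOn (fun x => min (hardDensityLS K u x) (hardDensityLS K v x)) (Icc (0 : ℝ) 1) := by
  simp only [min_hardDensityLS K hK]
  refine Integrable.add (by simp) (integrable_finsetSum _ fun j _ => ?_)
  exact (integrable_min_hatFun K hK _ _ _).indicator measurableSet_Ico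

lemma integral_min_hardDensityLS (K : ℕ) (hK : 0 < K) (u v : Fin K → Fin 3) :
    ∫ x in Icc (0 : ℝ) 1, min (hardDensityLS K u x) (hardDensityLS K v x)
      = 1 - (∑ j, |trit (u j) - trit (v j)|) / (16 * (K : ℝ) ^ 2) := by
  have hK' : (0 : ℝ) < K := by exact_mod_cast hK
  have hint := fun j : Fin K => (integrable_min_hatFun K hK (u j) (v j)
    (((j : ℝ) + 1 / 2) / K)).indicator
      (measurableSet_Ico (a := (j : ℝ) / (K : ℝ)) (b := ((j : ℝ) + 1) / (K : ℝ)))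
  simp only [min_hardDensityLS K hK]
  rw [integral_add (by simp) (integrable_finsetSum _ fun j _ => hint j),
    integral_finsetSum _ fun j _ => hint j]
  have hj : ∀ j : Fin K, ∫ x in Icc (0 : ℝ) 1,
      (Ico ((j : ℝ) / (K : ℝ)) (((j : ℝ) + 1) / (K : ℝ))).indicator (fun x =>
        min (trit (u j) * hatFun K (x - ((j : ℝ) + 1 / 2) / K))
          (trit (v j) * hatFun K (x - ((j : ℝ) + 1 / 2) / K))) x
      = -|trit (u j) - trit (v j)| / (16 * (K : ℝ) ^ 2) := fun j => by
    have hjK : (j : ℝ) + 1 ≤ K := by exact_mod_cast j.2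
    have hsub : Ico ((j : ℝ) / (K : ℝ)) (((j : ℝ) + 1) / (K : ℝ)) ⊆ Icc 0 1 := by
      refine Ico_subset_Icc_self.trans (Icc_subset_Icc (by positivity) ?_)
      rwa [div_le_one hK']
    rw [setIntegral_indicator measurableSet_Ico, inter_eq_self_of_subset_right hsub,
      integral_Ico_eq_integral_Ioc, ← intervalIntegral.integral_of_le (by gcongr; linarith),
      intervalIntegral.integral_comp_sub_right
        (fun x => min (trit (u j) * hatFun K x) (trit (v j) * hatFun K x)),
      ← integral_min_mul_hatFun K hK]
    congr 1 <;> field_simp <;> ring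
  rw [Finset.sum_congr rfl fun j _ => hj j, ← Finset.sum_div, Finset.sum_neg_distrib]
  simp
  ring

lemma labelMeasure_apply (p : ℝ → ℝ) (y : Bool) (s : Set (ℝ × Bool)) :
    labelMeasure p y s = ((volume.restrict (Icc (0 : ℝ) 1)).withDensity
      fun x => ENNReal.ofReal (p x)) {x | (x, y) ∈ s} :=
  (measurableEmbedding_prod_mk_right y).map_apply _ _

lemma bayesRisk_testMeasure (p q : ℝ → ℝ) (hp : Measurable p) (hq : Measurable q)
    (hp0 : ∀ x, 0 ≤ p x) (hq0 : ∀ x, 0 ≤ q x)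
    (hpi : IntegrableOn p (Icc (0 : ℝ) 1)) (hqi : IntegrableOn q (Icc (0 : ℝ) 1)) :
    bayesRisk (testMeasure (labelMeasure p true) (labelMeasure q false))
      = (1 / 2) * ∫ x in Icc (0 : ℝ) 1, min (p x) (q x) := by
  set lam : Measure ℝ := volume.restrict (Icc (0 : ℝ) 1) with hlam
  have hmi : Integrable (fun x => min (p x) (q x)) lam := hpi.inf hqi
  have hrisk : ∀ f : ℝ → Bool,
      risk f (testMeasure (labelMeasure p true) (labelMeasure q false)) =
        (2⁻¹ * ((lam.withDensity fun x => ENNReal.ofReal (p x)) {x | f x = false} +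
          (lam.withDensity fun x => ENNReal.ofReal (q x)) {x | f x = true})).toReal := by
    intro f
    simp [risk, testMeasure, labelMeasure_apply, mul_add, hlam]
  set mu := lam.withDensity fun x => ENNReal.ofReal (min (p x) (q x)) with hmu
  have hmuniv : mu univ = ENNReal.ofReal (∫ x, min (p x) (q x) ∂lam) := by
    rw [hmu, withDensity_apply _ MeasurableSet.univ, Measure.restrict_univ,
      ofReal_integral_eq_lintegral_ofReal hmi (.of_forall fun x => le_min (hp0 x) (hq0 x))]
  have hval : (1 / 2) * ∫ x, min (p x) (q x) ∂lam = (2⁻¹ * mu univ).toReal := by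
    rw [hmuniv, ENNReal.toReal_mul,
      ENNReal.toReal_ofReal (integral_nonneg fun x => le_min (hp0 x) (hq0 x))]
    simp
  have hfin : ∀ r : ℝ → ℝ, Integrable r lam →
      IsFiniteMeasure (lam.withDensity fun x => ENNReal.ofReal (r x)) := fun r hr =>
    isFiniteMeasure_withDensity_ofReal hr.2
  have := hfin p hpi
  have := hfin q hqi
  rw [hval]
  refine IsLeast.csInf_eq ⟨⟨fun x => decide (q x ≤ p x), ?_⟩, ?_⟩
  · simp only [hrisk, decide_eq_false_iff_not, decide_eq_true_eq]
    have hs : MeasurableSet {x | q x ≤ p x} := measurableSet_le hq hp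
    have hc : {x | ¬ q x ≤ p x} = {x | q x ≤ p x}ᶜ := rfl
    rw [hc, withDensity_apply _ hs.compl, withDensity_apply _ hs,
      ← measure_add_measure_compl (μ := mu) hs, hmu, withDensity_apply _ hs.compl,
      withDensity_apply _ hs, add_comm]
    congr 3
    · exact setLIntegral_congr_fun hs fun x hx => by
        have hx' : q x ≤ p x := hx
        simp only [min_eq_right hx']
    · exact setLIntegral_congr_fun hs.compl fun x hx => by
        have hx' : p x ≤ q x := (not_le.1 (show ¬ q x ≤ p x from hx)).le
        simp only [min_eq_left hx']
  · rintro _ ⟨f, rfl⟩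
    simp only [hrisk]
    refine ENNReal.toReal_mono (by finiteness) ?_
    gcongr
    have hu : (univ : Set ℝ) = {x | f x = false} ∪ {x | f x = true} := by
      ext x; cases h : f x <;> simp [h]
    rw [hu]
    refine (measure_union_le _ _).trans (add_le_add ?_ ?_)
    · exact withDensity_mono (.of_forall fun x => ENNReal.ofReal_le_ofReal (min_le_left _ _)) _
    · exact withDensity_mono (.of_forall fun x => ENNReal.ofReal_le_ofReal (min_le_right _ _)) _

lemma sum_pi_apply {ι β : Type*} [Fintype ι] [DecidableEq ι] [Fintype β] [Nonempty β] (j : ι) (g : β → ℝ) :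
    ∑ v : ι → β, g (v j) = Fintype.card (ι → β) / Fintype.card β * ∑ b, g b := by
  have hβ : (Fintype.card β : ℝ) ≠ 0 := by exact_mod_cast Fintype.card_ne_zero
  rw [← (Equiv.funSplitAt j β).symm.sum_comp, Fintype.card_congr (Equiv.funSplitAt j β),
    Fintype.sum_prod_type]
  simp [Equiv.funSplitAt, Equiv.piSplitAt, ← Finset.mul_sum]

lemma sum_abs_trit_sub (K : ℕ) :
    ∑ v : TritPair K, ∑ j, |trit (v.1 j) - trit (v.2 j)|
      = (8 / 9) * K * (Fintype.card (TritPair K) : ℝ) := by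
  rw [Finset.sum_comm]
  have h : ∀ j : Fin K, ∑ v : TritPair K, |trit (v.1 j) - trit (v.2 j)|
      = (8 / 9) * (Fintype.card (TritPair K) : ℝ) := fun j => by
    rw [Fintype.sum_prod_type]
    dsimp only
    rw [Finset.sum_congr rfl fun (x : Fin K → Fin 3) _ =>
      sum_pi_apply j fun b => |trit (x j) - trit b|, ← Finset.mul_sum, sum_pi_apply j fun a => ∑ b, |trit a - trit b|]
    have : ∑ a : Fin 3, ∑ b : Fin 3, |trit a - trit b| = 8 := by
      simp [Fin.sum_univ_three, trit]; norm_num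
    rw [this, Fintype.card_prod]
    push_cast [Fintype.card_fin]
    ring
  simp [h]
  ring

/-- **Lemma.** For the hard label-shift family, with `V` uniform on
`{-1,0,1}^K × {-1,0,1}^K` and `P_{V,test}(x,y) = (1/2)(P_{V,1}(x) 1{y=1} + P_{V,-1}(x) 1{y=-1})`,
the expected Bayes risk is `E_V[R(f^*(P_{V,test}); P_{V,test})] = (1/2)(1 - 1/(18K))`. -/
theorem expected_bayes_risk_hard_family (K : ℕ) (hK : 0 < K) :
    (∑ v : TritPair K,
        bayesRisk (testMeasure (labelMeasure (hardDensityLS K v.1) true)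
          (labelMeasure (hardDensityLS K v.2) false))) /
        (Fintype.card (TritPair K) : ℝ)
      = (1/2) * (1 - 1/(18*(K:ℝ))) := by
  have hK' : (0 : ℝ) < K := by exact_mod_cast hK
  have hcard : (Fintype.card (TritPair K) : ℝ) ≠ 0 := by
    exact_mod_cast Fintype.card_ne_zero
  have hint : ∀ v, IntegrableOn (hardDensityLS K v) (Icc (0 : ℝ) 1) := fun v => by
    simpa only [min_self] using integrableOn_min_hardDensityLS K hK v v
  have hrisk : ∀ v : TritPair K,
      bayesRisk (testMeasure (labelMeasure (hardDensityLS K v.1) true)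
          (labelMeasure (hardDensityLS K v.2) false)) =
        1 / 2 - (∑ j, |trit (v.1 j) - trit (v.2 j)|) / (32 * (K : ℝ) ^ 2) := fun v => by
    rw [bayesRisk_testMeasure _ _ (measurable_hardDensityLS K v.1)
      (measurable_hardDensityLS K v.2) (hardDensityLS_nonneg K hK v.1)
      (hardDensityLS_nonneg K hK v.2) (hint v.1) (hint v.2),
      integral_min_hardDensityLS K hK]
    ring
  rw [Finset.sum_congr rfl fun v _ => hrisk v, Finset.sum_sub_distrib,
    ← Finset.sum_div (f := fun v : TritPair K => ∑ j, |trit (v.1 j) - trit (v.2 j)|),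
    sum_abs_trit_sub, Finset.sum_const, Finset.card_univ, nsmul_eq_mul]
  generalize (Fintype.card (TritPair K) : ℝ) = N at *
  field_simp
  ring
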